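/- arXiv:2206.13013 — 8 statements merged into one kernel-verified Lean document; each statement's English description precedes it below -/
import Mathlib

section
/- Let K be an algebraically closed field with an absolute value, and let f(z) and g(z) be polynomials in K[z], both of degree n ≥ 1. Then g(z) is ε-aligned to f(z) for every ε > 0 if and only if there exists c ∈ K with c ≠ 0 such that g(z) = c·f(z). -/
open Polynomial
open scoped Classical

/-- `g` is `ε`-aligned to `f` if for every (distinct) root `ζ` of `f`, with multiplicity
`μ` as a root of `f`, the open ball `B(ζ, ε)` contains at least `μ` roots of `g`,
counted with multiplicity. -/
def EpsAligned {K : Type*} [NormedField K] (ε : ℝ) (f g : Polynomial K) : Prop :=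
  ∀ ζ : K, f.IsRoot ζ →
    Polynomial.rootMultiplicity ζ f ≤
      Multiset.card (Multiset.filter (fun ω => ‖ω - ζ‖ < ε) g.roots)

/-- Points of a finite multiset that are close enough to `ζ` are equal to `ζ`. -/
theorem Multiset.exists_pos_forall_norm_sub_lt_imp_eq {E : Type*} [NormedAddCommGroup E]
    (s : Multiset E) (ζ : E) : ∃ ε > (0 : ℝ), ∀ ω ∈ s, ‖ω - ζ‖ < ε → ω = ζ := by
  induction s using Multiset.induction with
  | empty => exact ⟨1, one_pos, by simp⟩
  | cons a s ih =>
    obtain ⟨ε, hε, h⟩ := ih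
    by_cases ha : a = ζ
    · refine ⟨ε, hε, fun ω hω hlt => ?_⟩
      rcases Multiset.mem_cons.1 hω with rfl | hω
      exacts [ha, h ω hω hlt]
    · refine ⟨min ε ‖a - ζ‖, lt_min hε (norm_pos_iff.2 (sub_ne_zero.2 ha)), fun ω hω hlt => ?_⟩
      rcases Multiset.mem_cons.1 hω with rfl | hω
      exacts [absurd (hlt.trans_le (min_le_right _ _)) (lt_irrefl _),
        h ω hω (hlt.trans_le (min_le_left _ _))]

/-- Being `ε`-aligned for every `ε > 0` amounts to an inclusion of root multisets. -/
theorem epsAligned_forall_iff_roots_le {K : Type*} [NormedField K] (f g : Polynomial K) :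
    (∀ ε > 0, EpsAligned ε f g) ↔ f.roots ≤ g.roots := by
  constructor
  · intro h
    refine Multiset.le_iff_count.2 fun ζ => ?_
    rw [count_roots]
    by_cases hζ : f.IsRoot ζ
    · obtain ⟨ε, hε, hroots⟩ := g.roots.exists_pos_forall_norm_sub_lt_imp_eq ζ
      refine (h ε hε ζ hζ).trans ?_
      rw [Multiset.count, Multiset.countP_eq_card_filter]
      exact Multiset.card_le_card (Multiset.le_filter.2 ⟨Multiset.filter_le _ _, fun ω hω =>
        (hroots ω (Multiset.mem_filter.1 hω).1 (Multiset.mem_filter.1 hω).2).symm⟩)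
    · simp [rootMultiplicity_eq_zero hζ]
  · intro h ε hε ζ _
    rw [← count_roots]
    refine (Multiset.count_le_of_le ζ h).trans ?_
    rw [Multiset.count, Multiset.countP_eq_card_filter]
    refine Multiset.card_le_card (Multiset.monotone_filter_right _ fun ω hω => ?_)
    simpa [← hω] using hε

/-- For polynomials `f, g` of degree `n ≥ 1` over an algebraically closed
field with an absolute value, `g` is `ε`-aligned to `f` for every `ε > 0` iff
`g = c • f` for some nonzero `c`. -/
theorem epsAligned_forall_iff_smul {K : Type*} [NormedField K] [IsAlgClosed K] {n : ℕ}
    (hn : 1 ≤ n) (f g : Polynomial K) (hf : f.natDegree = n) (hg : g.natDegree = n) :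
    (∀ ε > 0, EpsAligned ε f g) ↔ ∃ c : K, c ≠ 0 ∧ g = Polynomial.C c * f := by
  have hf0 : f ≠ 0 := ne_zero_of_natDegree_gt (n := 0) (by omega)
  have hg0 : g ≠ 0 := ne_zero_of_natDegree_gt (n := 0) (by omega)
  rw [epsAligned_forall_iff_roots_le]
  constructor
  · intro h
    have hroots : f.roots = g.roots := Multiset.eq_of_le_of_card_le h <| by
      rw [← (IsAlgClosed.splits f).natDegree_eq_card_roots,
        ← (IsAlgClosed.splits g).natDegree_eq_card_roots, hf, hg]
    have hlf : f.leadingCoeff ≠ 0 := leadingCoeff_ne_zero.2 hf0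
    refine ⟨g.leadingCoeff / f.leadingCoeff, div_ne_zero (leadingCoeff_ne_zero.2 hg0) hlf, ?_⟩
    calc
      g = C g.leadingCoeff * (f.roots.map (X - C ·)).prod := by
        rw [hroots, ← (IsAlgClosed.splits g).eq_prod_roots]
      _ = C (g.leadingCoeff / f.leadingCoeff) *
          (C f.leadingCoeff * (f.roots.map (X - C ·)).prod) := by
        rw [← mul_assoc, ← C_mul, div_mul_cancel₀ _ hlf]
      _ = C (g.leadingCoeff / f.leadingCoeff) * f := by
        rw [← (IsAlgClosed.splits f).eq_prod_roots]
  · rintro ⟨c, hc, rfl⟩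
    rw [roots_C_mul f hc]
end

section
/- Let K be an algebraically closed field with an absolute value, let a_n ∈ K with a_n ≠ 0, let n ≥ 1, and let f(z) = a_n z^n. Let 0 < ε < 1 and let δ satisfy 0 < δ < ε^n · |a_n| / (2n). If g(z) ∈ K[z] is a polynomial of degree n that is a δ-deformation of f(z), then every root ω of g(z) satisfies |ω| < ε. -/
open Polynomial

/-- Let `f = a·zⁿ` with `a ≠ 0`, `n ≥ 1`, let `0 < ε < 1` and
`0 < δ < εⁿ·|a| / (2n)`. If `g` is a degree-`n` polynomial that is a `δ`-deformation
of `f`, then every root `ω` of `g` satisfies `|ω| < ε`. -/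
theorem roots_small_of_deformation_monomial_explicit {K : Type*} [NormedField K]
    [IsAlgClosed K] {n : ℕ} (hn : 1 ≤ n) (a : K) (ha : a ≠ 0) (f : Polynomial K)
    (hf : f = Polynomial.C a * Polynomial.X ^ n) {ε δ : ℝ}
    (hε0 : 0 < ε) (hε1 : ε < 1) (hδ0 : 0 < δ) (hδ : δ < ε ^ n * ‖a‖ / (2 * n))
    (g : Polynomial K) (hg : g.natDegree = n)
    (hdef : ∀ i ≤ n, ‖g.coeff i - f.coeff i‖ < δ) :
    ∀ ω : K, g.IsRoot ω → ‖ω‖ < ε := by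
  intro ω hω
  by_contra! hr
  set M : ℝ := max 1 ‖ω‖
  have hM1 : 1 ≤ M := le_max_left _ _
  have hMn : 0 < M ^ n := by positivity
  have hδn : δ * (n + 1) < ε ^ n * ‖a‖ := by
    have hn' : (1 : ℝ) ≤ n := by exact_mod_cast hn
    rw [lt_div_iff₀ (by positivity)] at hδ
    nlinarith
  have hεM : ε * M ≤ ‖ω‖ := by
    rw [mul_max_of_nonneg _ _ hε0.le]
    exact max_le (by linarith) (mul_le_of_le_one_left (norm_nonneg _) hε1.le)
  have hfdeg : f.natDegree < n + 1 := by
    rw [hf, natDegree_C_mul_X_pow n a ha]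
    exact n.lt_succ_self
  have hsum : ∑ i ∈ Finset.range (n + 1), (g.coeff i - f.coeff i) * ω ^ i = -(a * ω ^ n) := by
    simp only [sub_mul, Finset.sum_sub_distrib]
    rw [← eval_eq_sum_range' (by omega) ω, ← eval_eq_sum_range' hfdeg ω, hω.eq_zero, hf]
    simp
  have hupper : ‖a‖ * ‖ω‖ ^ n ≤ δ * (n + 1) * M ^ n := by
    calc ‖a‖ * ‖ω‖ ^ n = ‖∑ i ∈ Finset.range (n + 1), (g.coeff i - f.coeff i) * ω ^ i‖ := by
          rw [hsum, norm_neg, norm_mul, norm_pow]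
      _ ≤ ∑ _i ∈ Finset.range (n + 1), δ * M ^ n := by
          refine norm_sum_le_of_le _ fun i hi => ?_
          have hin : i ≤ n := Finset.mem_range_succ_iff.mp hi
          rw [norm_mul, norm_pow]
          refine mul_le_mul (hdef i hin).le ?_ (by positivity) hδ0.le
          exact (pow_le_pow_left₀ (norm_nonneg _) (le_max_right _ _) i).trans
            (pow_le_pow_right₀ hM1 hin)
      _ = δ * (n + 1) * M ^ n := by
          simp only [Finset.sum_const, Finset.card_range, nsmul_eq_mul]
          push_cast
          ring
  have hlower : ε ^ n * ‖a‖ * M ^ n ≤ ‖a‖ * ‖ω‖ ^ n := by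
    calc ε ^ n * ‖a‖ * M ^ n = ‖a‖ * (ε * M) ^ n := by ring
      _ ≤ ‖a‖ * ‖ω‖ ^ n := by gcongr
  exact (mul_lt_mul_of_pos_right hδn hMn).not_ge (hlower.trans hupper)
end

section
/- Let K be an algebraically closed field with an absolute value, and let f(z) ∈ K[z] be a polynomial of degree n ≥ 1. For every ε > 0 there exists δ > 0, depending only on ε and f, such that: if g(z) ∈ K[z] is a polynomial of degree n that is a δ-deformation of f(z), then for every root ζ of f(z) there exists a root ω of g(z) with |ω − ζ| < ε. -/
open Polynomial

/-- If every element of a multiset `s` is at distance at least `ε` from `x`, then the product of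
the differences `x - a`, for `a ∈ s`, has norm at least `ε ^ card s`. -/
theorem Multiset.pow_card_le_norm_prod_sub {K : Type*} [NormedField K] {ε : ℝ} (hε : 0 ≤ ε) (x : K)
    (s : Multiset K) (h : ∀ a ∈ s, ε ≤ ‖a - x‖) :
    ε ^ s.card ≤ ‖(s.map fun a => x - a).prod‖ := by
  induction s using Multiset.induction_on with
  | empty => simp
  | cons a s ih =>
    rw [Multiset.card_cons, Multiset.map_cons, Multiset.prod_cons, norm_mul, pow_succ',
      norm_sub_rev]
    exact mul_le_mul (h a (Multiset.mem_cons_self a s))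
      (ih fun b hb => h b (Multiset.mem_cons_of_mem hb)) (pow_nonneg hε _) (norm_nonneg _)

/-- If a split polynomial has no root within `ε` of `x`, then its value at `x` has norm at least
the norm of its leading coefficient times `ε` to the power of its degree. -/
theorem Polynomial.Splits.norm_leadingCoeff_mul_pow_le_norm_eval {K : Type*} [NormedField K]
    {g : K[X]} (hg : g.Splits) {ε : ℝ} (hε : 0 ≤ ε) (x : K)
    (h : ∀ a ∈ g.roots, ε ≤ ‖a - x‖) :
    ‖g.leadingCoeff‖ * ε ^ g.natDegree ≤ ‖g.eval x‖ := by
  rw [hg.eval_eq_prod_roots, norm_mul, hg.natDegree_eq_card_roots]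
  gcongr
  exact Multiset.pow_card_le_norm_prod_sub hε x _ h

/-- If the coefficients of two polynomials of degree at most `n` differ by at most `δ`, then their
values at `x` differ by at most `δ * ∑ i ≤ n, ‖x‖ ^ i`. -/
theorem Polynomial.norm_eval_sub_eval_le {K : Type*} [NormedField K] {n : ℕ} {f g : K[X]}
    (hf : f.natDegree ≤ n) (hg : g.natDegree ≤ n) {δ : ℝ}
    (h : ∀ i ≤ n, ‖g.coeff i - f.coeff i‖ ≤ δ) (x : K) :
    ‖g.eval x - f.eval x‖ ≤ δ * ∑ i ∈ Finset.range (n + 1), ‖x‖ ^ i := by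
  rw [eval_eq_sum_range' (Nat.lt_succ_of_le hf), eval_eq_sum_range' (Nat.lt_succ_of_le hg),
    ← Finset.sum_sub_distrib, Finset.mul_sum]
  refine norm_sum_le_of_le _ fun i hi => ?_
  rw [← sub_mul, norm_mul, norm_pow]
  gcongr
  exact h i (Nat.lt_succ_iff.1 (Finset.mem_range.1 hi))

/-- Let `f` be a polynomial of degree `n ≥ 1` over an algebraically
closed field with an absolute value. For every `ε > 0` there exists `δ > 0` (depending
only on `ε` and `f`) such that if `g` is a degree-`n` polynomial that is a
`δ`-deformation of `f`, then every root of `f` lies within `ε` of some root of `g`. -/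
theorem exists_near_root_of_deformation {K : Type*} [NormedField K] [IsAlgClosed K]
    {n : ℕ} (hn : 1 ≤ n) (f : Polynomial K) (hf : f.natDegree = n) :
    ∀ ε > 0, ∃ δ > 0, ∀ g : Polynomial K, g.natDegree = n →
      (∀ i ≤ n, ‖g.coeff i - f.coeff i‖ < δ) →
      ∀ ζ : K, f.IsRoot ζ → ∃ ω : K, g.IsRoot ω ∧ ‖ω - ζ‖ < ε := by
  classical
  intro ε hε
  have hf0 : f ≠ 0 := by
    rintro rfl
    simp at hf
    omega
  have hA : 0 < ‖f.coeff n‖ := by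
    rw [← hf, coeff_natDegree]
    exact norm_pos_iff.2 (leadingCoeff_ne_zero.2 hf0)
  set S : K → ℝ := fun z => ∑ i ∈ Finset.range (n + 1), ‖z‖ ^ i
  have hS : ∀ z, 0 ≤ S z := fun z => Finset.sum_nonneg fun i _ => by positivity
  set M : ℝ := ∑ z ∈ f.roots.toFinset, S z + 1
  have hM : 0 < M := add_pos_of_nonneg_of_pos (Finset.sum_nonneg fun z _ => hS z) one_pos
  refine ⟨min (‖f.coeff n‖ / 2) (‖f.coeff n‖ / 2 * ε ^ n / M), by positivity, ?_⟩
  set δ : ℝ := min (‖f.coeff n‖ / 2) (‖f.coeff n‖ / 2 * ε ^ n / M)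
  have hδ : 0 < δ := by positivity
  intro g hg hgf ζ hζ
  by_contra! hfar
  have hSM : S ζ < M := by
    have : S ζ ≤ ∑ z ∈ f.roots.toFinset, S z :=
      Finset.single_le_sum (fun z _ => hS z) (by simpa [hf0] using hζ)
    linarith
  have hlower := (IsAlgClosed.splits g).norm_leadingCoeff_mul_pow_le_norm_eval hε.le ζ
    fun a ha => hfar a (isRoot_of_mem_roots ha)
  have hupper := norm_eval_sub_eval_le hf.le hg.le (fun i hi => (hgf i hi).le) ζ
  rw [hζ.eq_zero, sub_zero] at hupper
  rw [leadingCoeff, hg] at hlower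
  have hlead : ‖f.coeff n‖ / 2 ≤ ‖g.coeff n‖ := by
    have h₁ := (hgf n le_rfl).trans_le (min_le_left _ _)
    have h₂ := norm_sub_norm_le (f.coeff n) (g.coeff n)
    rw [norm_sub_rev] at h₂
    linarith
  have hδM : δ * M ≤ ‖f.coeff n‖ / 2 * ε ^ n := (le_div_iff₀ hM).1 (min_le_right _ _)
  have hlt : δ * S ζ < δ * M := mul_lt_mul_of_pos_left hSM hδ
  have hle : ‖f.coeff n‖ / 2 * ε ^ n ≤ ‖g.coeff n‖ * ε ^ n := by gcongr
  linarith
end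

section
/- Let K be an algebraically closed field with an absolute value, and let f(z) = Σ_{i=0}^n a_i z^i ∈ K[z] be a polynomial of degree n ≥ 1 with distinct roots ζ_1, …, ζ_ℓ. Let M = max(1, |ζ_1|, …, |ζ_ℓ|), let 0 < ε < M, and let δ satisfy 0 < δ < (|a_n| / (2(n+1))) · (ε/M)^n. If g(z) ∈ K[z] is a polynomial of degree n that is a δ-deformation of f(z), then for every root ζ of f(z) there exists a root ω of g(z) with |ω − ζ| ≤ (2(n+1)δ / |a_n|)^{1/n} · M < ε. -/
open Polynomial
open scoped Classical

/-- If all roots of a polynomial over an algebraically closed normed field are at distance at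
least `R` from `z`, then `‖p(z)‖` is at least the norm of the leading coefficient times
`R ^ deg p`. -/
theorem Polynomial.norm_leadingCoeff_mul_pow_le_norm_eval {K : Type*} [NormedField K]
    [IsAlgClosed K] (p : Polynomial K) (z : K) {R : ℝ} (hR : 0 ≤ R)
    (h : ∀ w ∈ p.roots, R ≤ ‖w - z‖) :
    ‖p.leadingCoeff‖ * R ^ p.natDegree ≤ ‖p.eval z‖ := by
  have hs : p.Splits := IsAlgClosed.splits p
  have key : ∀ s : Multiset K, (∀ w ∈ s, R ≤ ‖w - z‖) →
      R ^ s.card ≤ ‖(s.map (z - ·)).prod‖ := by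
    intro s
    induction s using Multiset.induction_on with
    | empty => simp
    | cons a s ih =>
      intro has
      have ha := has a (Multiset.mem_cons_self a s)
      have ih' := ih fun w hw => has w (Multiset.mem_cons_of_mem hw)
      rw [Multiset.card_cons, pow_succ', Multiset.map_cons, Multiset.prod_cons, norm_mul,
        norm_sub_rev]
      gcongr
  rw [hs.eval_eq_prod_roots, norm_mul, hs.natDegree_eq_card_roots]
  exact mul_le_mul_of_nonneg_left (key _ h) (norm_nonneg _)

/-- A polynomial of degree at most `n` with coefficients of norm at most `δ` is bounded by
`(n + 1) * δ * M ^ n` at points of norm at most `M`, for `M ≥ 1`. -/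
theorem Polynomial.norm_eval_le_of_norm_coeff_le {K : Type*} [NormedField K] {n : ℕ}
    (p : Polynomial K) (hp : p.natDegree ≤ n) {δ M : ℝ} (hδ : ∀ i ≤ n, ‖p.coeff i‖ ≤ δ)
    (hM : 1 ≤ M) {z : K} (hz : ‖z‖ ≤ M) : ‖p.eval z‖ ≤ (n + 1) * δ * M ^ n := by
  rw [eval_eq_sum_range' (Nat.lt_succ_of_le hp)]
  calc ‖∑ i ∈ Finset.range (n + 1), p.coeff i * z ^ i‖
      ≤ ∑ i ∈ Finset.range (n + 1), ‖p.coeff i * z ^ i‖ := norm_sum_le _ _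
    _ ≤ ∑ _i ∈ Finset.range (n + 1), δ * M ^ n := by
        refine Finset.sum_le_sum fun i hi => ?_
        have hin : i ≤ n := Nat.lt_succ_iff.mp (Finset.mem_range.mp hi)
        rw [norm_mul, norm_pow]
        have hc := hδ i hin
        have hpow : ‖z‖ ^ i ≤ M ^ n :=
          (pow_le_pow_left₀ (norm_nonneg _) hz i).trans (pow_le_pow_right₀ hM hin)
        exact mul_le_mul hc hpow (by positivity) ((norm_nonneg _).trans hc)
    _ = (n + 1) * δ * M ^ n := by simp [mul_assoc]

/-- (Explicit version of Theorem on nearby roots.) Let `f` have degree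
`n ≥ 1` with leading coefficient `aₙ = f.coeff n`, let
`M = max(1, |ζ₁|, …, |ζ_ℓ|)` over the distinct roots `ζ₁, …, ζ_ℓ` of `f`, let
`0 < ε < M` and `0 < δ < (|aₙ|/(2(n+1)))·(ε/M)ⁿ`. If `g` is a degree-`n` polynomial
that is a `δ`-deformation of `f`, then for every root `ζ` of `f` there is a root `ω` of
`g` with `|ω − ζ| ≤ (2(n+1)δ/|aₙ|)^{1/n}·M < ε`. -/
theorem exists_near_root_of_deformation_explicit {K : Type*} [NormedField K]
    [IsAlgClosed K] {n : ℕ} (hn : 1 ≤ n) (f : Polynomial K) (hf : f.natDegree = n)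
    (M ε δ : ℝ)
    (hM : M = (insert (1 : ℝ) (f.roots.toFinset.image fun ζ => ‖ζ‖)).max'
      (Finset.insert_nonempty _ _))
    (hε0 : 0 < ε) (hεM : ε < M) (hδ0 : 0 < δ)
    (hδ : δ < ‖f.coeff n‖ / (2 * (n + 1)) * (ε / M) ^ n)
    (g : Polynomial K) (hg : g.natDegree = n)
    (hdef : ∀ i ≤ n, ‖g.coeff i - f.coeff i‖ < δ) :
    ∀ ζ : K, f.IsRoot ζ → ∃ ω : K, g.IsRoot ω ∧
      ‖ω - ζ‖ ≤ (2 * (n + 1) * δ / ‖f.coeff n‖) ^ ((n : ℝ)⁻¹) * M ∧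
      (2 * (n + 1) * δ / ‖f.coeff n‖) ^ ((n : ℝ)⁻¹) * M < ε := by
  intro ζ hζ
  have hf0 : f ≠ 0 := by
    rintro rfl
    simp at hf
    omega
  have ha : 0 < ‖f.coeff n‖ := by
    rw [norm_pos_iff, ← hf]
    exact leadingCoeff_ne_zero.mpr hf0
  have hM1 : 1 ≤ M := hM ▸ Finset.le_max' _ _ (Finset.mem_insert_self _ _)
  have hζM : ‖ζ‖ ≤ M := by
    rw [hM]
    refine Finset.le_max' _ _ (Finset.mem_insert_of_mem (Finset.mem_image_of_mem _ ?_))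
    rwa [Multiset.mem_toFinset, mem_roots hf0]
  have hM0 : 0 < M := by linarith
  have hn0 : n ≠ 0 := by omega
  set c : ℝ := 2 * (n + 1) * δ / ‖f.coeff n‖ with hc
  have hc0 : 0 < c := by positivity
  have hcδ : c * ‖f.coeff n‖ = 2 * (n + 1) * δ := by rw [hc]; field_simp
  have hcε : c < (ε / M) ^ n := by
    rw [hc, div_lt_iff₀ ha]
    calc 2 * (n + 1) * δ
        < 2 * (n + 1) * (‖f.coeff n‖ / (2 * (n + 1)) * (ε / M) ^ n) := by gcongr
      _ = (ε / M) ^ n * ‖f.coeff n‖ := by field_simp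
  have hε1 : (ε / M) ^ n ≤ 1 :=
    pow_le_one₀ (by positivity) ((div_le_one hM0).mpr hεM.le)
  set r : ℝ := c ^ ((n : ℝ)⁻¹) with hr
  have hr0 : 0 < r := Real.rpow_pos_of_pos hc0 _
  have hrn : r ^ n = c := Real.rpow_inv_natCast_pow hc0.le hn0
  have hrε : r * M < ε := by
    rw [← lt_div_iff₀ hM0]
    exact lt_of_pow_lt_pow_left₀ n (by positivity) (hrn ▸ hcε)
  have hb : ‖f.coeff n‖ / 2 < ‖g.coeff n‖ := by
    have h1 := hdef n le_rfl
    have h2 := norm_sub_norm_le (f.coeff n) (g.coeff n)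
    rw [norm_sub_rev] at h2
    have h3 : (2 : ℝ) * δ ≤ 2 * (n + 1) * δ := by nlinarith [Nat.cast_nonneg (α := ℝ) n]
    nlinarith
  by_contra! hcon
  have hfar : ∀ w ∈ g.roots, r * M ≤ ‖w - ζ‖ := by
    intro w hw
    by_contra! hlt
    exact (hcon w (isRoot_of_mem_roots hw) hlt.le).not_gt hrε
  have hlow := g.norm_leadingCoeff_mul_pow_le_norm_eval ζ (by positivity) hfar
  have hup := (g - f).norm_eval_le_of_norm_coeff_le (n := n) (δ := δ)
    ((natDegree_sub_le g f).trans (by simp [hf, hg]))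
    (fun i hi => by simpa using (hdef i hi).le) hM1 hζM
  rw [eval_sub, hζ.eq_zero, sub_zero] at hup
  rw [leadingCoeff, hg, mul_pow, hrn] at hlow
  have hmid : ‖f.coeff n‖ / 2 * (c * M ^ n) < ‖g.coeff n‖ * (c * M ^ n) := by gcongr
  have heq : ‖f.coeff n‖ / 2 * (c * M ^ n) = (n + 1) * δ * M ^ n := by
    linear_combination M ^ n / 2 * hcδ
  linarith
end

section
/- Let K be a field with an absolute value. Let f(z) = Σ_{i=0}^n a_i z^i ∈ K[z] be a polynomial of degree n ≥ 1 and let ζ_1 be a nonzero root of f(z); write f̂(z) = f(z)/(z − ζ_1) = Σ_{i=0}^{n−1} â_i z^i. For every λ > 0 there exists κ > 0 such that: if g(z) = Σ_{i=0}^n b_i z^i ∈ K[z] is a polynomial of degree n that is a κ-deformation of f(z), and ω_1 is a nonzero root of g(z) with |ω_1 − ζ_1| < κ, then the polynomial ĝ(z) = g(z)/(z − ω_1) = Σ_{i=0}^{n−1} b̂_i z^i is a λ-deformation of f̂(z). -/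
open Polynomial

/-- Coefficients of the quotient by `X - a`, as a function of finitely many coefficients. -/
theorem coeff_divByMonic_X_sub_C_eq_sum_ofNat {R : Type*} [CommRing R] {p : R[X]} {n : ℕ}
    (hp : p.natDegree = n) (a : R) (i : ℕ) :
    (p /ₘ (X - C a)).coeff i = ∑ j ∈ Finset.Icc (i + 1) n,
      a ^ (j - (i + 1)) * p.coeff (Fin.ofNat (n + 1) j : Fin (n + 1)) := by
  rw [coeff_divByMonic_X_sub_C, hp]
  refine Finset.sum_congr rfl fun j hj => ?_
  rw [Fin.val_ofNat, Nat.mod_eq_of_lt (Nat.lt_succ_of_le (Finset.mem_Icc.mp hj).2)]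

/-- Let `f` be a degree-`n ≥ 1` polynomial over a field with an
absolute value, with a nonzero root `ζ₁`, and let `f̂ = f / (X − ζ₁)`. For every
`λ > 0` there exists `κ > 0` such that if `g` is a degree-`n` polynomial that is a
`κ`-deformation of `f` and `ω₁` is a nonzero root of `g` with `|ω₁ − ζ₁| < κ`, then
`ĝ = g / (X − ω₁)` is a `λ`-deformation of `f̂`. -/
theorem deformation_divByMonic {K : Type*} [NormedField K] {n : ℕ} (hn : 1 ≤ n)
    (f : Polynomial K) (hf : f.natDegree = n) (ζ₁ : K) (hζ : ζ₁ ≠ 0)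
    (hroot : f.IsRoot ζ₁) :
    ∀ lam > 0, ∃ κ > 0, ∀ (g : Polynomial K) (ω₁ : K),
      g.natDegree = n → (∀ i ≤ n, ‖g.coeff i - f.coeff i‖ < κ) →
      ω₁ ≠ 0 → g.IsRoot ω₁ → ‖ω₁ - ζ₁‖ < κ →
      ∀ i ≤ n - 1,
        ‖(g /ₘ (Polynomial.X - Polynomial.C ω₁)).coeff i -
          (f /ₘ (Polynomial.X - Polynomial.C ζ₁)).coeff i‖ < lam := by
  intro lam hlam
  let F : (Fin (n + 1) → K) × K → Fin n → K := fun x i =>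
    ∑ j ∈ Finset.Icc ((i : ℕ) + 1) n, x.2 ^ (j - ((i : ℕ) + 1)) * x.1 (Fin.ofNat (n + 1) j)
  have hF : Continuous F := by fun_prop
  obtain ⟨κ, hκ, h⟩ := Metric.continuous_iff.mp hF (fun j => f.coeff j, ζ₁) lam hlam
  refine ⟨κ, hκ, fun g ω₁ hg hcoeff _ _ hω i hi => ?_⟩
  have hdist : dist ((fun j : Fin (n + 1) => g.coeff j), ω₁) (fun j => f.coeff j, ζ₁) < κ := by
    rw [Prod.dist_eq, max_lt_iff, dist_pi_lt_iff hκ]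
    refine ⟨fun j => ?_, by rwa [dist_eq_norm]⟩
    rw [dist_eq_norm]
    exact hcoeff j (Nat.le_of_lt_succ j.isLt)
  have hi' := (dist_pi_lt_iff hlam).mp (h _ hdist) ⟨i, by lia⟩
  rw [coeff_divByMonic_X_sub_C_eq_sum_ofNat hg, coeff_divByMonic_X_sub_C_eq_sum_ofNat hf]
  rwa [dist_eq_norm] at hi'
end

section
/- Let K be an algebraically closed field with an absolute value, and let f(z) ∈ K[z] be a polynomial of degree n ≥ 1 that has at least one nonzero root. For every ε > 0 there exists δ > 0 such that: if g(z) ∈ K[z] is a polynomial of degree n that is a δ-deformation of f(z), then g(z) is ε-aligned to f(z). -/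
open Polynomial
open scoped Classical

open Filter Topology

/-- A splitting polynomial has a root `w` whose distance to `x` is controlled by its value at `x`. -/
lemma exists_isRoot_norm_leadingCoeff_mul_pow_le {K : Type*} [NormedField K] {g : K[X]}
    (hg : g.Splits) (hdeg : g.natDegree ≠ 0) (x : K) :
    ∃ w : K, g.IsRoot w ∧ ‖g.leadingCoeff‖ * ‖w - x‖ ^ g.natDegree ≤ ‖g.eval x‖ := by
  have hcard : Multiset.card g.roots = g.natDegree := hg.natDegree_eq_card_roots.symm
  have hne : g.roots.toFinset.Nonempty := by
    rw [Multiset.toFinset_nonempty, ← Multiset.card_pos, hcard]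
    exact Nat.pos_of_ne_zero hdeg
  obtain ⟨w, hw, hmin⟩ := g.roots.toFinset.exists_min_image (fun y => ‖y - x‖) hne
  refine ⟨w, isRoot_of_mem_roots (Multiset.mem_toFinset.1 hw), ?_⟩
  have hnorm : ‖(g.roots.map (x - ·)).prod‖ = (g.roots.map fun y => ‖y - x‖).prod := by
    rw [← normHom_apply, map_multiset_prod, Multiset.map_map]
    simp only [Function.comp_def, normHom_apply, norm_sub_rev]
  have hprod := Multiset.prod_map_le_prod_map₀ (s := g.roots) (fun _ => ‖w - x‖)
    (fun y => ‖y - x‖) (fun _ _ => norm_nonneg _)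
    (fun y hy => hmin y (Multiset.mem_toFinset.2 hy))
  rw [Multiset.map_const', Multiset.prod_replicate, hcard] at hprod
  rw [hg.eval_eq_prod_roots, norm_mul, hnorm]
  gcongr

/-- If the coefficients of polynomials `g i` of the same degree as `f` converge to those of `f`,
then every root of `f` is the limit of roots of the `g i`. -/
lemma exists_isRoot_tendsto_of_tendsto_coeff {K : Type*} [NormedField K] [IsAlgClosed K]
    {ι : Type*} {l : Filter ι} {f : K[X]} {g : ι → K[X]} {x : K}
    (hf : f.natDegree ≠ 0) (hx : f.IsRoot x) (hdeg : ∀ i, (g i).natDegree = f.natDegree)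
    (hlim : ∀ k, Tendsto (fun i => (g i).coeff k) l (𝓝 (f.coeff k))) :
    ∃ w : ι → K, (∀ i, (g i).IsRoot (w i)) ∧ Tendsto w l (𝓝 x) := by
  choose w hroot hle using fun i => exists_isRoot_norm_leadingCoeff_mul_pow_le
    (IsAlgClosed.splits (g i)) (by rwa [hdeg i]) x
  refine ⟨w, hroot, Metric.tendsto_nhds.2 fun ε hε => ?_⟩
  have hlead : Tendsto (fun i => ‖(g i).leadingCoeff‖ * ε ^ f.natDegree) l
      (𝓝 (‖f.leadingCoeff‖ * ε ^ f.natDegree)) := by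
    simp only [leadingCoeff, hdeg]
    exact (hlim _).norm.mul_const _
  have heval : Tendsto (fun i => ‖(g i).eval x‖) l (𝓝 0) := by
    have h : Tendsto (fun i => (g i).eval x) l (𝓝 (f.eval x)) := by
      simp only [eval_eq_sum_range, hdeg]
      exact tendsto_finsetSum _ fun k _ => (hlim k).mul_const _
    simpa [hx.eq_zero] using h.norm
  have hf0 : f ≠ 0 := by rintro rfl; simp at hf
  have hpos : 0 < ‖f.leadingCoeff‖ * ε ^ f.natDegree :=
    mul_pos (norm_pos_iff.2 (leadingCoeff_ne_zero.2 hf0)) (pow_pos hε _)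
  filter_upwards [heval.eventually_lt hlead hpos] with i hi
  have h := (hle i).trans_lt hi
  rw [hdeg i] at h
  rw [dist_eq_norm]
  exact lt_of_pow_lt_pow_left₀ _ hε.le (lt_of_mul_lt_mul_left h (norm_nonneg _))

/-- If the coefficients of polynomials `g i` of the same degree as `f` converge to those of `f`,
then each ball around a root of `f` eventually contains at least as many roots of `g i` as the
multiplicity of that root. -/
lemma eventually_le_card_filter_roots {K : Type*} [NormedField K] [IsAlgClosed K]
    {ι : Type*} {l : Filter ι} {x : K} {ε : ℝ} (hε : 0 < ε) {m : ℕ} {f : K[X]} {g : ι → K[X]}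
    (hf : f ≠ 0) (hm : (X - C x) ^ m ∣ f) (hdeg : ∀ i, (g i).natDegree = f.natDegree)
    (hlim : ∀ k, Tendsto (fun i => (g i).coeff k) l (𝓝 (f.coeff k))) :
    ∀ᶠ i in l, m ≤ Multiset.card ((g i).roots.filter fun y => ‖y - x‖ < ε) := by
  induction m generalizing f g with
  | zero => exact Eventually.of_forall fun _ => Nat.zero_le _
  | succ m ih =>
    have hx : f.IsRoot x := dvd_iff_isRoot.1 ((dvd_pow_self _ m.succ_ne_zero).trans hm)
    have hf' := mul_divByMonic_eq_iff_isRoot.2 hx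
    have hdeg0 : f.natDegree ≠ 0 := (natDegree_pos_iff_degree_pos.2 (degree_pos_of_root hf hx)).ne'
    obtain ⟨w, hroot, hw⟩ := exists_isRoot_tendsto_of_tendsto_coeff hdeg0 hx hdeg hlim
    have key := ih (f := f /ₘ (X - C x)) (g := fun i => g i /ₘ (X - C (w i)))
      (fun h => hf (by rw [← hf', h, mul_zero]))
      (by
        rw [← hf', pow_succ'] at hm
        exact (mul_dvd_mul_iff_left (X_sub_C_ne_zero x)).1 hm)
      (fun i => by simp only [natDegree_divByMonic _ (monic_X_sub_C _), natDegree_X_sub_C, hdeg])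
      (fun k => by
        simp only [coeff_divByMonic_X_sub_C, hdeg]
        exact tendsto_finsetSum _ fun j _ => (hw.pow _).mul (hlim j))
    filter_upwards [key, Metric.tendsto_nhds.1 hw ε hε] with i hi hwi
    have hgi := mul_divByMonic_eq_iff_isRoot.2 (hroot i)
    have hgi0 : g i ≠ 0 := fun h => hdeg0 (by rw [← hdeg i, h, natDegree_zero])
    rw [dist_eq_norm] at hwi
    rw [← hgi, roots_mul (by rwa [hgi]), roots_X_sub_C, Multiset.singleton_add,
      Multiset.filter_cons_of_pos (p := fun y => ‖y - x‖ < ε) _ hwi, Multiset.card_cons]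
    exact Nat.succ_le_succ hi

/-- (Continuity of roots for polynomials with a nonzero root.)
Let `f` be a degree-`n ≥ 1` polynomial over an algebraically closed field with an
absolute value, having at least one nonzero root. For every `ε > 0` there exists
`δ > 0` such that every degree-`n` polynomial `g` that is a `δ`-deformation of `f`
is `ε`-aligned to `f`. -/
theorem epsAligned_of_deformation_of_nonzero_root {K : Type*} [NormedField K]
    [IsAlgClosed K] {n : ℕ} (hn : 1 ≤ n) (f : Polynomial K) (hf : f.natDegree = n)
    (hnz : ∃ ζ : K, ζ ≠ 0 ∧ f.IsRoot ζ) :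
    ∀ ε > 0, ∃ δ > 0, ∀ g : Polynomial K, g.natDegree = n →
      (∀ i ≤ n, ‖g.coeff i - f.coeff i‖ < δ) → EpsAligned ε f g := by
  intro ε hε
  by_contra! hcon
  have hf0 : f ≠ 0 := by rintro rfl; simp at hf; omega
  choose g hdeg hclose hbad using fun m : ℕ => hcon (1 / ((m : ℝ) + 1)) Nat.one_div_pos_of_nat
  have hlim : ∀ k, Tendsto (fun m => (g m).coeff k) atTop (𝓝 (f.coeff k)) := by
    intro k
    rcases le_or_gt k n with hk | hk
    · exact tendsto_iff_norm_sub_tendsto_zero.2 <| squeeze_zero (fun _ => norm_nonneg _)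
        (fun m => (hclose m k hk).le) tendsto_one_div_add_atTop_nhds_zero_nat
    · have hg : ∀ m, (g m).coeff k = 0 := fun m =>
        coeff_eq_zero_of_natDegree_lt ((hdeg m).trans_lt hk)
      simp only [hg, coeff_eq_zero_of_natDegree_lt (hf.trans_lt hk)]
      exact tendsto_const_nhds
  have hall : ∀ᶠ m in atTop, ∀ ζ ∈ f.roots.toFinset, rootMultiplicity ζ f ≤
      Multiset.card ((g m).roots.filter fun ω => ‖ω - ζ‖ < ε) :=
    (eventually_all_finset _).2 fun ζ _ => eventually_le_card_filter_roots hε hf0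
      (pow_rootMultiplicity_dvd f ζ) (fun m => (hdeg m).trans hf.symm) hlim
  obtain ⟨m, hm⟩ := hall.exists
  exact hbad m fun ζ hζ => hm ζ (Multiset.mem_toFinset.2 ((mem_roots hf0).2 hζ))
end

section
/- Let K be an algebraically closed field with an absolute value, and let f(z) ∈ K[z] be a polynomial of degree n ≥ 1. For every ε > 0 there exists δ > 0 such that: if g(z) ∈ K[z] is a polynomial of degree n that is a δ-deformation of f(z), then g(z) is ε-aligned to f(z). -/
open Polynomial
open scoped Classical

open Filter Topology

section ContinuityOfRoots

variable {K ι : Type*} [NormedField K] {l : Filter ι} {f : K[X]} {G : ι → K[X]} {ζ : K}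

theorem tendsto_eval_of_tendsto_coeff (hdeg : ∀ i, (G i).natDegree = f.natDegree)
    (hG : ∀ k, Tendsto (fun i => (G i).coeff k) l (𝓝 (f.coeff k))) (x : K) :
    Tendsto (fun i => (G i).eval x) l (𝓝 (f.eval x)) := by
  simp only [eval_eq_sum_range, hdeg]
  exact tendsto_finsetSum _ fun k _ => (hG k).mul_const _

/-- The root `ω` of `p` nearest to `x` satisfies `‖lc p‖ * ‖x - ω‖ ^ deg p ≤ ‖p x‖`. -/
theorem exists_isRoot_norm_pow_le [IsAlgClosed K] {p : K[X]} (hp : p.natDegree ≠ 0) (x : K) :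
    ∃ ω, p.IsRoot ω ∧ ‖p.leadingCoeff‖ * ‖x - ω‖ ^ p.natDegree ≤ ‖p.eval x‖ := by
  have hp0 : p ≠ 0 := by rintro rfl; simp at hp
  have hne : p.roots.toFinset.Nonempty := by
    obtain ⟨ω, hω⟩ := IsAlgClosed.exists_root p fun h => hp (natDegree_eq_of_degree_eq_some h)
    exact ⟨ω, by simpa [hp0] using hω⟩
  obtain ⟨ω, hω, hmin⟩ := p.roots.toFinset.exists_min_image (fun ω => ‖x - ω‖) hne
  refine ⟨ω, by simpa [hp0] using hω, ?_⟩
  have hsplit := IsAlgClosed.splits p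
  rw [hsplit.eval_eq_prod_roots, norm_mul, hsplit.natDegree_eq_card_roots]
  refine mul_le_mul_of_nonneg_left ?_ (norm_nonneg _)
  have key : ∀ s : Multiset K, (∀ b ∈ s, ‖x - ω‖ ≤ ‖x - b‖) →
      ‖x - ω‖ ^ s.card ≤ ‖(s.map fun b => x - b).prod‖ := by
    intro s
    induction s using Multiset.induction_on with
    | empty => simp
    | cons b s ih =>
      intro h
      rw [Multiset.card_cons, Multiset.map_cons, Multiset.prod_cons, norm_mul, pow_succ']
      exact mul_le_mul (h b (by simp)) (ih fun c hc => h c (by simp [hc])) (by positivity)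
        (norm_nonneg _)
  exact key _ fun b hb => hmin b (Multiset.mem_toFinset.2 hb)

theorem exists_isRoot_tendsto [IsAlgClosed K] (hf : f ≠ 0) (hζ : f.IsRoot ζ)
    (hdeg : ∀ i, (G i).natDegree = f.natDegree)
    (hG : ∀ k, Tendsto (fun i => (G i).coeff k) l (𝓝 (f.coeff k))) :
    ∃ ω : ι → K, (∀ i, (G i).IsRoot (ω i)) ∧ Tendsto ω l (𝓝 ζ) := by
  have hn : f.natDegree ≠ 0 := (natDegree_pos_iff_degree_pos.2 (degree_pos_of_root hf hζ)).ne'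
  choose ω hω hle using fun i => exists_isRoot_norm_pow_le (p := G i) (by rwa [hdeg]) ζ
  refine ⟨ω, hω, ?_⟩
  have hquot : Tendsto (fun i => ‖(G i).eval ζ‖ / ‖(G i).coeff f.natDegree‖) l (𝓝 0) := by
    have h := (tendsto_eval_of_tendsto_coeff hdeg hG ζ).norm.div (hG f.natDegree).norm
      (norm_ne_zero_iff.2 (leadingCoeff_ne_zero.2 hf))
    simpa [hζ.eq_zero, Pi.div_def] using h
  rw [tendsto_iff_norm_sub_tendsto_zero, Metric.tendsto_nhds]
  intro ε hε
  filter_upwards [hquot.eventually (gt_mem_nhds (pow_pos hε f.natDegree))] with i hi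
  have hG0 : 0 < ‖(G i).leadingCoeff‖ := by
    rw [norm_pos_iff, leadingCoeff_ne_zero]
    intro h
    exact hn (by rw [← hdeg i, h, natDegree_zero])
  have h := hle i
  rw [mul_comm, ← le_div_iff₀ hG0, leadingCoeff, hdeg] at h
  rw [dist_zero_right, norm_norm, norm_sub_rev]
  exact lt_of_pow_lt_pow_left₀ _ hε.le (h.trans_lt hi)

/-- Dividing by linear factors is continuous in the coefficients and the root. -/
theorem tendsto_coeff_of_X_sub_C_mul {H : ι → K[X]} {ω : ι → K} (n : ℕ)
    (hf : f.natDegree ≤ n) (hH : ∀ i, (H i).natDegree ≤ n) (hω : Tendsto ω l (𝓝 ζ))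
    (hG : ∀ k, Tendsto (fun i => ((X - C (ω i)) * H i).coeff k) l
      (𝓝 (((X - C ζ) * f).coeff k))) (k : ℕ) :
    Tendsto (fun i => (H i).coeff k) l (𝓝 (f.coeff k)) := by
  have hrec : ∀ (p : K[X]) (a : K) (j : ℕ),
      p.coeff j = ((X - C a) * p).coeff (j + 1) + a * p.coeff (j + 1) := by
    intro p a j
    rw [sub_mul, coeff_sub, coeff_X_mul, coeff_C_mul, sub_add_cancel]
  rcases lt_or_ge n k with hk | hk
  · have hH0 : ∀ i, (H i).coeff k = 0 := fun i =>
      coeff_eq_zero_of_natDegree_lt ((hH i).trans_lt hk)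
    simpa [hH0, coeff_eq_zero_of_natDegree_lt (hf.trans_lt hk)] using tendsto_const_nhds
  · refine Nat.decreasingInduction' (P := fun k => Tendsto (fun i => (H i).coeff k) l
      (𝓝 (f.coeff k))) (n := n + 1) (fun j _ _ ih => ?_) (by omega) ?_
    · rw [hrec f ζ j]
      simp only [fun i => hrec (H i) (ω i) j]
      exact (hG (j + 1)).add (hω.mul ih)
    · have hH0 : ∀ i, (H i).coeff (n + 1) = 0 := fun i =>
        coeff_eq_zero_of_natDegree_lt (Nat.lt_succ_of_le (hH i))
      simpa [hH0, coeff_eq_zero_of_natDegree_lt (Nat.lt_succ_of_le hf)] using tendsto_const_nhds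

theorem eventually_le_card_roots_near [IsAlgClosed K] {ε : ℝ} (hε : 0 < ε) (m : ℕ)
    (hf : f ≠ 0) (hm : (X - C ζ) ^ m ∣ f) (hdeg : ∀ i, (G i).natDegree = f.natDegree)
    (hG : ∀ k, Tendsto (fun i => (G i).coeff k) l (𝓝 (f.coeff k))) :
    ∀ᶠ i in l, m ≤ ((G i).roots.filter fun ω => ‖ω - ζ‖ < ε).card := by
  induction m generalizing f G with
  | zero => simp
  | succ m ih =>
    obtain ⟨q, hq⟩ := hm
    rw [pow_succ', mul_assoc] at hq
    set p := (X - C ζ) ^ m * q with hp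
    have hp0 : p ≠ 0 := by rintro h; simp [h] at hq; exact hf hq
    have hζ : f.IsRoot ζ := dvd_iff_isRoot.1 ⟨p, hq⟩
    obtain ⟨ω, hω, hωlim⟩ := exists_isRoot_tendsto hf hζ hdeg hG
    choose H hH using fun i => dvd_iff_isRoot.2 (hω i)
    have hfdeg : f.natDegree = 1 + p.natDegree := by
      rw [hq, natDegree_mul (X_sub_C_ne_zero ζ) hp0, natDegree_X_sub_C]
    have hG0 : ∀ i, G i ≠ 0 := fun i h => by
      have := hdeg i
      rw [h, natDegree_zero] at this
      omega
    have hH0 : ∀ i, H i ≠ 0 := fun i h => hG0 i (by rw [hH, h, mul_zero])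
    have hHdeg : ∀ i, (H i).natDegree = p.natDegree := fun i => by
      have := hdeg i
      rw [hH, natDegree_mul (X_sub_C_ne_zero _) (hH0 i), natDegree_X_sub_C] at this
      omega
    have hHlim := tendsto_coeff_of_X_sub_C_mul p.natDegree le_rfl (fun i => (hHdeg i).le) hωlim
      (by simpa only [← hH, ← hq] using hG)
    filter_upwards [ih hp0 ⟨q, hp⟩ hHdeg hHlim, hωlim (Metric.ball_mem_nhds ζ hε)] with i hi hωi
    have hωi' : ‖ω i - ζ‖ < ε := by simpa [dist_eq_norm] using hωi
    rw [hH i, roots_mul (hH i ▸ hG0 i), roots_X_sub_C, Multiset.singleton_add,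
      Multiset.filter_cons_of_pos (p := fun x => ‖x - ζ‖ < ε) _ hωi', Multiset.card_cons]
    omega

theorem eventually_epsAligned [IsAlgClosed K] {ε : ℝ} (hε : 0 < ε) (hf : f ≠ 0)
    (hdeg : ∀ i, (G i).natDegree = f.natDegree)
    (hG : ∀ k, Tendsto (fun i => (G i).coeff k) l (𝓝 (f.coeff k))) :
    ∀ᶠ i in l, EpsAligned ε f (G i) := by
  have h : ∀ᶠ i in l, ∀ ζ ∈ f.roots.toFinset, rootMultiplicity ζ f ≤
      ((G i).roots.filter fun ω => ‖ω - ζ‖ < ε).card :=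
    (eventually_all_finset _).2 fun ζ _ => eventually_le_card_roots_near hε _ hf
      (pow_rootMultiplicity_dvd f ζ) hdeg hG
  filter_upwards [h] with i hi ζ hζ
  exact hi ζ (by simpa [hf] using hζ)

end ContinuityOfRoots

/-- (Continuity of roots.) Let `f` be a degree-`n ≥ 1` polynomial over
an algebraically closed field with an absolute value. For every `ε > 0` there exists
`δ > 0` such that every degree-`n` polynomial `g` that is a `δ`-deformation of `f` is
`ε`-aligned to `f`. -/
theorem epsAligned_of_deformation {K : Type*} [NormedField K] [IsAlgClosed K] {n : ℕ}
    (hn : 1 ≤ n) (f : Polynomial K) (hf : f.natDegree = n) :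
    ∀ ε > 0, ∃ δ > 0, ∀ g : Polynomial K, g.natDegree = n →
      (∀ i ≤ n, ‖g.coeff i - f.coeff i‖ < δ) → EpsAligned ε f g := by
  intro ε hε
  have hf0 : f ≠ 0 := by
    rintro rfl
    simp at hf
    omega
  by_contra! h
  choose G hdeg hclose hbad using fun k : ℕ => h (1 / ((k : ℝ) + 1)) (by positivity)
  have hlim : ∀ j, Tendsto (fun k => (G k).coeff j) atTop (𝓝 (f.coeff j)) := by
    intro j
    rcases le_or_gt j n with hj | hj
    · rw [tendsto_iff_norm_sub_tendsto_zero]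
      exact squeeze_zero (fun _ => norm_nonneg _) (fun k => (hclose k j hj).le)
        tendsto_one_div_add_atTop_nhds_zero_nat
    · have hG0 : ∀ k, (G k).coeff j = 0 := fun k =>
        coeff_eq_zero_of_natDegree_lt ((hdeg k).trans_lt hj)
      simp [hG0, coeff_eq_zero_of_natDegree_lt (hf.trans_lt hj)]
  obtain ⟨k, hk⟩ := (eventually_epsAligned hε hf0 (fun k => (hdeg k).trans hf.symm) hlim).exists
  exact hbad k hk
end

section
/- Let K be an algebraically closed field with an absolute value, and let f(z) ∈ K[z] be a polynomial of degree n ≥ 1 with roots ζ_1, …, ζ_n listed with multiplicity. For every ε > 0 there exists δ > 0 such that: if g(z) ∈ K[z] is a polynomial of degree n that is a δ-deformation of f(z), with roots ω_1, …, ω_n listed with multiplicity, then there exists a permutation σ of {1, …, n} such that |ω_{σ(j)} − ζ_j| < ε for all j ∈ {1, …, n}. -/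
open Polynomial

/-- Two tuples listing the same elements with the same multiplicities agree up to a permutation
of the indices. -/
theorem exists_perm_comp_eq_of_ofFn_perm {α : Type*} {n : ℕ} {u v : Fin n → α}
    (h : (List.ofFn u).Perm (List.ofFn v)) : ∃ σ : Equiv.Perm (Fin n), u ∘ σ = v := by
  classical
  let : LinearOrder α := linearOrderOfSTO WellOrderingRel
  have key : u ∘ Tuple.sort u = v ∘ Tuple.sort v :=
    List.ofFn_injective <|
      ((((Tuple.sort u).ofFn_comp_perm u).trans h).trans
        ((Tuple.sort v).ofFn_comp_perm v).symm).eq_of_pairwise'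
        (Tuple.monotone_sort u).sortedLE_ofFn.pairwise
        (Tuple.monotone_sort v).sortedLE_ofFn.pairwise
  refine ⟨(Tuple.sort v).symm.trans (Tuple.sort u), funext fun i => ?_⟩
  simpa using congrFun key ((Tuple.sort v).symm i)

namespace Polynomial

open Filter Topology

theorem roots_eq_cons_divByMonic {R : Type*} [CommRing R] [IsDomain R] {p : R[X]} {a : R}
    (hp : p ≠ 0) (ha : p.IsRoot a) : p.roots = a ::ₘ (p /ₘ (X - C a)).roots := by
  have h := mul_divByMonic_eq_iff_isRoot.2 ha
  have h0 : (X - C a) * (p /ₘ (X - C a)) ≠ 0 := by rwa [h]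
  conv_lhs => rw [← h, roots_mul h0, roots_X_sub_C, Multiset.singleton_add]

theorem Splits.exists_mem_roots_norm_mul_pow_le {K : Type*} [NormedField K] {g : K[X]}
    (hg : g.Splits) (hdeg : g.natDegree ≠ 0) (a : K) :
    ∃ r ∈ g.roots, ‖g.leadingCoeff‖ * ‖a - r‖ ^ g.natDegree ≤ ‖g.eval a‖ := by
  classical
  have hcard : g.roots.card = g.natDegree := hg.natDegree_eq_card_roots.symm
  have hne : g.roots.toFinset.Nonempty := by
    rw [Multiset.toFinset_nonempty]
    intro h
    simp [h] at hcard
    exact hdeg hcard.symm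
  obtain ⟨r, hr, hmin⟩ := g.roots.toFinset.exists_min_image (fun x => ‖a - x‖) hne
  refine ⟨r, Multiset.mem_toFinset.1 hr, ?_⟩
  have hprod : ‖(g.roots.map fun x => a - x).prod‖ = (g.roots.map fun x => ‖a - x‖).prod := by
    simpa [Multiset.map_map, Function.comp_def] using
      map_multiset_prod (normHom : K →*₀ ℝ) (g.roots.map fun x => a - x)
  rw [hg.eval_eq_prod_roots, norm_mul, hprod]
  gcongr
  have := Multiset.prod_map_le_prod_map₀ (s := g.roots) (fun _ => ‖a - r‖) (fun x => ‖a - x‖)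
    (fun _ _ => norm_nonneg _) (fun x hx => hmin x (Multiset.mem_toFinset.2 hx))
  simpa [hcard] using this

section Tendsto

variable {ι K : Type*} {l : Filter ι}

theorem tendsto_coeff_divByMonic_X_sub_C [CommRing K] [TopologicalSpace K] [IsTopologicalRing K]
    {n : ℕ} {f : K[X]} {F : ι → K[X]} (hf : f.natDegree = n) (hF : ∀ t, (F t).natDegree = n)
    (hlim : ∀ i, Tendsto (fun t => (F t).coeff i) l (𝓝 (f.coeff i)))
    {a : K} {r : ι → K} (hr : Tendsto r l (𝓝 a)) (i : ℕ) :
    Tendsto (fun t => (F t /ₘ (X - C (r t))).coeff i) l (𝓝 ((f /ₘ (X - C a)).coeff i)) := by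
  simp only [coeff_divByMonic_X_sub_C, hf, hF]
  exact tendsto_finsetSum _ fun j _ => (hr.pow _).mul (hlim j)

theorem tendsto_eval_of_tendsto_coeff [CommRing K] [TopologicalSpace K] [IsTopologicalRing K]
    {n : ℕ} {f : K[X]} {F : ι → K[X]} (hf : f.natDegree = n) (hF : ∀ t, (F t).natDegree = n)
    (hlim : ∀ i, Tendsto (fun t => (F t).coeff i) l (𝓝 (f.coeff i))) (a : K) :
    Tendsto (fun t => (F t).eval a) l (𝓝 (f.eval a)) := by
  simp only [eval_eq_sum_range, hf, hF]
  exact tendsto_finsetSum _ fun j _ => (hlim j).mul tendsto_const_nhds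

variable [NormedField K] [IsAlgClosed K]

theorem exists_isRoot_tendsto {n : ℕ} {f : K[X]} {F : ι → K[X]}
    (hf : f.natDegree = n + 1) (hF : ∀ t, (F t).natDegree = n + 1)
    (hlim : ∀ i, Tendsto (fun t => (F t).coeff i) l (𝓝 (f.coeff i)))
    {a : K} (ha : f.IsRoot a) :
    ∃ r : ι → K, (∀ t, (F t).IsRoot (r t)) ∧ Tendsto r l (𝓝 a) := by
  choose r hr hle using fun t => (IsAlgClosed.splits (F t)).exists_mem_roots_norm_mul_pow_le
    (by simp [hF t]) a
  refine ⟨r, fun t => isRoot_of_mem_roots (hr t), ?_⟩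
  have hc : f.coeff (n + 1) ≠ 0 := by
    rw [← hf, coeff_natDegree, leadingCoeff_ne_zero]
    rintro rfl
    simp at hf
  have hpos (t : ι) : 0 < ‖(F t).coeff (n + 1)‖ := by
    rw [← hF t, coeff_natDegree, norm_pos_iff, leadingCoeff_ne_zero]
    intro h
    simpa [h] using hF t
  have hq : Tendsto (fun t => ‖(F t).eval a‖ / ‖(F t).coeff (n + 1)‖) l (𝓝 0) := by
    have := (tendsto_eval_of_tendsto_coeff hf hF hlim a).norm.div (hlim (n + 1)).norm
      (norm_ne_zero_iff.2 hc)
    simpa [ha.eq_zero, Pi.div_def] using this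
  rw [Metric.tendsto_nhds]
  intro ε hε
  filter_upwards [hq.eventually_lt_const (pow_pos hε (n + 1))] with t ht
  rw [dist_comm, dist_eq_norm]
  refine lt_of_pow_lt_pow_left₀ (n + 1) hε.le (lt_of_le_of_lt ?_ ht)
  rw [le_div_iff₀' (hpos t)]
  simpa only [leadingCoeff, hF t] using hle t

/-- Continuity of roots along a filter: if the coefficients of the polynomials `F t`, all of the
same degree as `f`, tend to those of `f`, then the roots of `F t` can be listed so that they tend
to the roots of `f`. -/
theorem exists_roots_eq_ofFn_tendsto {n : ℕ} {f : K[X]} {F : ι → K[X]} {ζ : Fin n → K}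
    (hf : f.natDegree = n) (hζ : f.roots = ↑(List.ofFn ζ)) (hF : ∀ t, (F t).natDegree = n)
    (hlim : ∀ i, Tendsto (fun t => (F t).coeff i) l (𝓝 (f.coeff i))) :
    ∃ ω : ι → Fin n → K, (∀ t, (F t).roots = ↑(List.ofFn (ω t))) ∧
      ∀ j, Tendsto (fun t => ω t j) l (𝓝 (ζ j)) := by
  induction n generalizing f F with
  | zero =>
    refine ⟨fun _ => ζ, fun t => ?_, fun j => j.elim0⟩
    rw [eq_C_of_natDegree_eq_zero (hF t)]
    simp
  | succ n ih =>
    have ne_zero {p : K[X]} (hp : p.natDegree = n + 1) : p ≠ 0 := by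
      rintro rfl
      simp at hp
    have natDegree_div {p : K[X]} (hp : p.natDegree = n + 1) (b : K) :
        (p /ₘ (X - C b)).natDegree = n := by
      simp [natDegree_divByMonic p (monic_X_sub_C b), hp]
    have ha : f.IsRoot (ζ 0) := isRoot_of_mem_roots (by simp [hζ])
    obtain ⟨r, hroot, hr⟩ := exists_isRoot_tendsto hf hF hlim ha
    have hζ' : (f /ₘ (X - C (ζ 0))).roots = ↑(List.ofFn fun i : Fin n => ζ i.succ) := by
      rw [roots_eq_cons_divByMonic (ne_zero hf) ha, List.ofFn_succ, ← Multiset.cons_coe] at hζ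
      exact (Multiset.cons_inj_right _).1 hζ
    obtain ⟨ω, hω, hωlim⟩ := ih (natDegree_div hf _) hζ'
      (fun t => natDegree_div (hF t) (r t)) (tendsto_coeff_divByMonic_X_sub_C hf hF hlim hr)
    refine ⟨fun t => Fin.cons (r t) (ω t), fun t => ?_, Fin.cases (by simpa using hr) ?_⟩
    · rw [roots_eq_cons_divByMonic (ne_zero (hF t)) (hroot t), hω t]
      simp [List.ofFn_succ]
    · intro j
      simpa using hωlim j

end Tendsto

end Polynomial

/-- (Continuity of roots, permutation form.) Let `f` be a degree-`n ≥ 1`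
polynomial over an algebraically closed field with an absolute value, with roots
`ζ 1, …, ζ n` listed with multiplicity. For every `ε > 0` there exists `δ > 0` such
that if `g` is a degree-`n` polynomial that is a `δ`-deformation of `f`, with roots
`ω 1, …, ω n` listed with multiplicity, then there is a permutation `σ` of `{1, …, n}`
with `|ω (σ j) − ζ j| < ε` for all `j`. -/
theorem continuity_of_roots_perm {K : Type*} [NormedField K] [IsAlgClosed K] {n : ℕ}
    (hn : 1 ≤ n) (f : Polynomial K) (hf : f.natDegree = n) (ζ : Fin n → K)
    (hζ : f.roots = ↑(List.ofFn ζ)) :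
    ∀ ε > 0, ∃ δ > 0, ∀ (g : Polynomial K) (ω : Fin n → K), g.natDegree = n →
      (∀ i ≤ n, ‖g.coeff i - f.coeff i‖ < δ) → g.roots = ↑(List.ofFn ω) →
      ∃ σ : Equiv.Perm (Fin n), ∀ j : Fin n, ‖ω (σ j) - ζ j‖ < ε := by
  intro ε hε
  let l : Filter {g : K[X] // g.natDegree = n} :=
    (nhds fun i : Fin (n + 1) => f.coeff i).comap fun g (i : Fin (n + 1)) => g.1.coeff i
  have hlim (i : ℕ) : Filter.Tendsto (fun g : {g : K[X] // g.natDegree = n} => g.1.coeff i) l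
      (nhds (f.coeff i)) := by
    rcases lt_or_ge i (n + 1) with hi | hi
    · have happly : Continuous fun v : Fin (n + 1) → K => v ⟨i, hi⟩ := continuous_apply _
      exact (happly.tendsto _).comp Filter.tendsto_comap
    · have h0 (p : K[X]) (hp : p.natDegree = n) : p.coeff i = 0 :=
        coeff_eq_zero_of_natDegree_lt (by omega)
      rw [h0 f hf]
      exact tendsto_const_nhds.congr fun g => (h0 g.1 g.2).symm
  obtain ⟨τ, hτ, hτlim⟩ := exists_roots_eq_ofFn_tendsto hf hζ (fun g => g.2) hlim
  have hev : ∀ᶠ g in l, ∀ j, dist (τ g j) (ζ j) < ε :=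
    Filter.eventually_all.2 fun j => Metric.tendsto_nhds.1 (hτlim j) ε hε
  obtain ⟨δ, hδ, hball⟩ := (Metric.nhds_basis_ball.comap _).eventually_iff.1 hev
  refine ⟨δ, hδ, fun g ω hg hgf hω => ?_⟩
  have hclose := @hball ⟨g, hg⟩ ((dist_pi_lt_iff hδ).2 fun i => by
    simpa [dist_eq_norm] using hgf i (Nat.le_of_lt_succ i.2))
  obtain ⟨σ, hσ⟩ := exists_perm_comp_eq_of_ofFn_perm
    (Multiset.coe_eq_coe.1 (hω.symm.trans (hτ ⟨g, hg⟩)))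
  refine ⟨σ, fun j => ?_⟩
  rw [← dist_eq_norm, ← Function.comp_apply (f := ω), hσ]
  exact hclose j
end
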